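/- Let G be a simple graph on [L]. There is a bijection between the set Π_{2p}(G) of pairs (π, φ), where π is a pair partition of [2p] and φ is a graph homomorphism from the intersection graph F_π to G, and the set P_{2p}(G) of closed paths of length 2p starting and ending at the empty word in the Cayley graph of the trace monoid T(G) with generating set [L]. -/

import Mathlib

def traceRel {V : Type*} (G : SimpleGraph V) :
    FreeMonoid V → FreeMonoid V → Prop := fun a b =>
  ∃ u v, G.Adj u v ∧ a = FreeMonoid.of u * FreeMonoid.of v ∧
    b = FreeMonoid.of v * FreeMonoid.of u

def traceCon {V : Type*} (G : SimpleGraph V) : Con (FreeMonoid V) :=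
  conGen (traceRel G)

abbrev TraceMonoid {V : Type*} (G : SimpleGraph V) := (traceCon G).Quotient

def tmOf {V : Type*} (G : SimpleGraph V) (v : V) : TraceMonoid G :=
  ((FreeMonoid.of v : FreeMonoid V) : (traceCon G).Quotient)

/-- Adjacency in the Cayley graph of the trace monoid: two elements are adjacent if one
is obtained from the other by left multiplication by a letter. -/
def CayleyAdj {V : Type*} (G : SimpleGraph V) (w₁ w₂ : TraceMonoid G) : Prop :=
  ∃ v : V, w₁ = tmOf G v * w₂ ∨ w₂ = tmOf G v * w₁

/-- Closed paths of length `2p` at the empty word in the Cayley graph of `T(G)`. -/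
def ClosedPaths {V : Type*} (G : SimpleGraph V) (p : ℕ) : Type _ :=
  {w : Fin (2 * p + 1) → TraceMonoid G //
    w 0 = 1 ∧ w (Fin.last (2 * p)) = 1 ∧
    ∀ k : Fin (2 * p), CayleyAdj G (w k.castSucc) (w k.succ)}

def IsPairPartition {n : ℕ} (π : Finpartition (Finset.univ : Finset (Fin n))) : Prop :=
  ∀ b ∈ π.parts, b.card = 2

def Crosses {n : ℕ} (b b' : Finset (Fin n)) : Prop :=
  ∃ u₁ u₂ v₁ v₂ : Fin n, u₁ < u₂ ∧ u₂ < v₁ ∧ v₁ < v₂ ∧ b = {u₁, v₁} ∧ b' = {u₂, v₂}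

def interGraph {n : ℕ} (π : Finpartition (Finset.univ : Finset (Fin n))) :
    SimpleGraph {b : Finset (Fin n) // b ∈ π.parts} :=
  SimpleGraph.fromRel (fun b b' => Crosses b.1 b'.1)

/-- Pairs `(π, φ)` of a pair partition of `[2p]` together with a graph homomorphism from
its intersection graph `F_π` to `G`. -/
def PairPartHoms {L : ℕ} (G : SimpleGraph (Fin L)) (p : ℕ) : Type _ :=
  Σ π : {π : Finpartition (Finset.univ : Finset (Fin (2 * p))) // IsPairPartition π},
    interGraph π.1 →g G

/-- The monoid homomorphism out of the trace monoid extending a map on letters which sends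
adjacent letters to commuting elements. -/
def traceLift {V M : Type*} [Monoid M] (G : SimpleGraph V) (f : V → M)
    (hf : ∀ u v, G.Adj u v → f u * f v = f v * f u) : TraceMonoid G →* M :=
  (traceCon G).lift (FreeMonoid.lift f) <| Con.conGen_le.2 <| by
    rintro _ _ ⟨u, v, huv, rfl, rfl⟩
    simpa [Con.ker_rel] using hf u v huv

@[simp]
theorem traceLift_tmOf {V M : Type*} [Monoid M] (G : SimpleGraph V) (f : V → M)
    (hf : ∀ u v, G.Adj u v → f u * f v = f v * f u) (v : V) :
    traceLift G f hf (tmOf G v) = f v :=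
  FreeMonoid.lift_eval_of f v

theorem tmOf_mul_comm {V : Type*} {G : SimpleGraph V} {u v : V} (h : G.Adj u v) :
    tmOf G u * tmOf G v = tmOf G v * tmOf G u :=
  ((traceCon G).eq (a := FreeMonoid.of u * FreeMonoid.of v)).2
    (ConGen.Rel.of _ _ ⟨u, v, h, rfl, rfl⟩)

/-- The element of the trace monoid represented by a word. -/
def traceWord {V : Type*} (G : SimpleGraph V) (l : List V) : TraceMonoid G :=
  (l.map (tmOf G)).prod

@[simp]
theorem traceWord_nil {V : Type*} (G : SimpleGraph V) : traceWord G [] = 1 := rfl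

@[simp]
theorem traceWord_cons {V : Type*} (G : SimpleGraph V) (v : V) (l : List V) :
    traceWord G (v :: l) = tmOf G v * traceWord G l := by
  simp [traceWord]

/-- The multiset of letters of an element of the trace monoid. -/
def traceLetters {V : Type*} (G : SimpleGraph V) :
    TraceMonoid G →* Multiplicative (Multiset V) :=
  traceLift G (fun v => Multiplicative.ofAdd {v}) fun _ _ _ => mul_comm _ _

theorem traceLetters_traceWord {V : Type*} (G : SimpleGraph V) (l : List V) :
    (traceLetters G (traceWord G l)).toAdd = (l : Multiset V) := by
  induction l with
  | nil => simp
  | cons v l ih =>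
    rw [traceWord_cons, map_mul, toAdd_mul, ih]
    simp [traceLetters]

theorem traceWord_append_cons {V : Type*} {G : SimpleGraph V} {v : V} (a b : List V)
    (h : ∀ u ∈ a, G.Adj u v) :
    traceWord G (a ++ v :: b) = tmOf G v * traceWord G (a ++ b) := by
  induction a with
  | nil => simp
  | cons u a ih =>
    simp only [List.mem_cons, forall_eq_or_imp] at h
    rw [List.cons_append, List.cons_append, traceWord_cons, traceWord_cons, ih h.2,
      ← mul_assoc, ← mul_assoc, tmOf_mul_comm h.1]

open Classical in
/-- The action of letters on pairs `(x, y)`, where `y` records the result of deleting the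
letter `v` from the left of `x`, if that is possible. -/
noncomputable def popLetter {V : Type*} (G : SimpleGraph V) (v u : V) :
    Function.End (TraceMonoid G × Option (TraceMonoid G)) :=
  fun x => (tmOf G u * x.1,
    if u = v then some x.1 else if G.Adj u v then x.2.map (tmOf G u * ·) else none)

theorem popLetter_comm {V : Type*} (G : SimpleGraph V) (v u u' : V) (h : G.Adj u u') :
    popLetter G v u * popLetter G v u' = popLetter G v u' * popLetter G v u := by
  funext ⟨x, y⟩
  have hne := h.ne
  have hc := tmOf_mul_comm h
  change popLetter G v u (popLetter G v u' (x, y)) = popLetter G v u' (popLetter G v u (x, y))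
  simp only [popLetter, ← mul_assoc, hc, Prod.mk.injEq, true_and]
  by_cases h1 : u = v
  · subst h1
    simp [hne.symm, h.symm]
  by_cases h2 : u' = v
  · subst h2
    simp [hne, h]
  by_cases h3 : G.Adj u v <;> by_cases h4 : G.Adj u' v <;> cases y <;>
    simp [h1, h2, h3, h4, ← mul_assoc, hc]

/-- Deletion of the letter `v`, as a homomorphism on the trace monoid. -/
noncomputable def popHom {V : Type*} (G : SimpleGraph V) (v : V) :
    TraceMonoid G →* Function.End (TraceMonoid G × Option (TraceMonoid G)) :=
  traceLift G (popLetter G v) (popLetter_comm G v)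

theorem popHom_tmOf_mul {V : Type*} (G : SimpleGraph V) (v u : V) (x : TraceMonoid G) :
    popHom G v (tmOf G u * x) (1, none) = popLetter G v u (popHom G v x (1, none)) := by
  rw [map_mul, popHom, traceLift_tmOf]
  rfl

theorem popHom_traceWord_fst {V : Type*} (G : SimpleGraph V) (v : V) (l : List V) :
    (popHom G v (traceWord G l) (1, none)).1 = traceWord G l := by
  induction l with
  | nil => rw [traceWord_nil, map_one]; rfl
  | cons u l ih => rw [traceWord_cons, popHom_tmOf_mul, popLetter, ih]

theorem exists_traceWord_eq {V : Type*} (G : SimpleGraph V) (x : TraceMonoid G) :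
    ∃ l, traceWord G l = x := by
  induction x using Con.induction_on with
  | H x =>
    induction x using FreeMonoid.inductionOn' with
    | one => exact ⟨[], rfl⟩
    | of_mul u x ih =>
      obtain ⟨l, hl⟩ := ih
      exact ⟨u :: l, by rw [traceWord_cons, hl]; rfl⟩

theorem exists_split_of_popHom {V : Type*} (G : SimpleGraph V) (v : V) (l : List V)
    (x : TraceMonoid G) (h : (popHom G v (traceWord G l) (1, none)).2 = some x) :
    ∃ a b, l = a ++ v :: b ∧ (∀ u ∈ a, G.Adj u v) ∧ x = traceWord G (a ++ b) := by
  induction l generalizing x with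
  | nil =>
    rw [traceWord_nil, map_one] at h
    exact absurd h (by simp [Function.End.one_def])
  | cons u l ih =>
    rw [traceWord_cons, popHom_tmOf_mul] at h
    simp only [popLetter, popHom_traceWord_fst] at h
    split_ifs at h with h1 h2
    · subst h1
      exact ⟨[], l, rfl, by simp, by simpa using h.symm⟩
    · obtain ⟨y, hy, rfl⟩ := Option.map_eq_some_iff.1 h
      obtain ⟨a, b, rfl, ha, rfl⟩ := ih y hy
      exact ⟨u :: a, b, rfl, by simpa [h2] using ha, by simp⟩

/-- A word representing a left multiple of the letter `v` contains an occurrence of `v`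
preceded only by letters adjacent to `v`, and dividing by `v` amounts to deleting it. -/
theorem exists_split_of_traceWord_eq {V : Type*} (G : SimpleGraph V) (v : V) (l : List V)
    (x : TraceMonoid G) (h : traceWord G l = tmOf G v * x) :
    ∃ a b, l = a ++ v :: b ∧ (∀ u ∈ a, G.Adj u v) ∧ x = traceWord G (a ++ b) := by
  apply exists_split_of_popHom
  obtain ⟨m, rfl⟩ := exists_traceWord_eq G x
  rw [h, popHom_tmOf_mul, popLetter]
  simp [popHom_traceWord_fst]

/-- An involution `σ` and a colouring `c` of the positions, constant on the orbits of `σ`,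
such that crossing orbits have adjacent colours. Fixed points of `σ` are regarded as left
ends of blocks which are never closed. -/
structure IsColoredMatching {V : Type*} (G : SimpleGraph V) {n : ℕ} (σ : Fin n → Fin n)
    (c : Fin n → V) : Prop where
  invol : ∀ i, σ (σ i) = i
  color : ∀ i, c (σ i) = c i
  cross : ∀ i j, i < j → j < σ i → (σ j = j ∨ σ i < σ j) → G.Adj (c i) (c j)

/-- The left ends of the blocks open at time `k`, the latest first. -/
def openList {n : ℕ} (σ : Fin n → Fin n) (k : ℕ) : List (Fin n) :=
  (List.finRange n).reverse.filter fun i => i.val < k ∧ (σ i = i ∨ k ≤ (σ i).val)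

theorem mem_openList {n : ℕ} {σ : Fin n → Fin n} {k : ℕ} {i : Fin n} :
    i ∈ openList σ k ↔ i.val < k ∧ (σ i = i ∨ k ≤ (σ i).val) := by
  simp [openList]

theorem pairwise_openList {n : ℕ} (σ : Fin n → Fin n) (k : ℕ) :
    (openList σ k).Pairwise (· > ·) := by
  apply List.Pairwise.filter
  rw [List.pairwise_reverse]
  exact List.pairwise_lt_finRange n

theorem List.eq_of_pairwise_gt_of_mem_iff {α : Type*} [LinearOrder α] {l l' : List α}
    (h : l.Pairwise (· > ·)) (h' : l'.Pairwise (· > ·)) (hm : ∀ a, a ∈ l ↔ a ∈ l') :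
    l = l' :=
  ((List.perm_ext_iff_of_nodup (h.imp ne_of_gt) (h'.imp ne_of_gt)).2 hm).eq_of_pairwise
    (fun _ _ _ _ hab hba => absurd hab (lt_asymm hba)) h h'

theorem openList_succ_of_le {n : ℕ} {σ : Fin n → Fin n} (k : Fin n) (hk : k ≤ σ k)
    (hσ : ∀ i, σ (σ i) = i) :
    openList σ (k + 1) = k :: openList σ k := by
  apply List.eq_of_pairwise_gt_of_mem_iff (pairwise_openList _ _)
  · rw [List.pairwise_cons]
    exact ⟨fun i hi => (mem_openList.1 hi).1, pairwise_openList _ _⟩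
  · intro i
    rw [List.mem_cons, mem_openList, mem_openList]
    have := hσ i
    grind

theorem openList_eq_of_lt {n : ℕ} {σ : Fin n → Fin n} (k : Fin n) (hk : σ k < k)
    (hσ : ∀ i, σ (σ i) = i) :
    ∃ a b, openList σ k = a ++ σ k :: b ∧ openList σ (k + 1) = a ++ b := by
  have hmem : σ k ∈ openList σ k := mem_openList.2 ⟨hk, Or.inr (by rw [hσ])⟩
  obtain ⟨a, b, hab⟩ := List.append_of_mem hmem
  refine ⟨a, b, hab, ?_⟩
  have hp := pairwise_openList σ k
  have hm : ∀ i, i ∈ openList σ k ↔ i ∈ a ++ σ k :: b := by simp [hab]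
  rw [hab] at hp
  apply List.eq_of_pairwise_gt_of_mem_iff (pairwise_openList _ _)
  · exact hp.sublist (by simp)
  · intro i
    have h1 := hm i
    have hnd : (a ++ σ k :: b).Nodup := hp.imp ne_of_gt
    have h2 : σ k ∉ a ++ b := (List.nodup_middle.1 hnd).notMem
    rw [mem_openList] at h1 ⊢
    have h3 := hσ i
    have h4 := hσ k
    simp only [List.mem_append, List.mem_cons] at h1 h2 ⊢
    have h5 : i = k ∨ i.val ≠ k.val := by omega
    have h6 : σ i = k ∨ (σ i).val ≠ k.val := by omega
    clear hm hp hnd hab hmem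
    grind

/-- The product of the colours of the blocks open at time `k`. -/
def openWord {V : Type*} (G : SimpleGraph V) {n : ℕ} (σ : Fin n → Fin n) (c : Fin n → V)
    (k : ℕ) : TraceMonoid G :=
  traceWord G ((openList σ k).map c)

namespace IsColoredMatching

variable {V : Type*} {G : SimpleGraph V} {n : ℕ} {σ τ : Fin n → Fin n} {c d : Fin n → V}

theorem openWord_succ (h : IsColoredMatching G σ c) (k : Fin n) (hk : k ≤ σ k) :
    openWord G σ c (k + 1) = tmOf G (c k) * openWord G σ c k := by
  simp [openWord, openList_succ_of_le k hk h.invol]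

theorem openWord_eq (h : IsColoredMatching G σ c) (k : Fin n) (hk : σ k < k) :
    openWord G σ c k = tmOf G (c k) * openWord G σ c (k + 1) := by
  obtain ⟨a, b, h1, h2⟩ := openList_eq_of_lt k hk h.invol
  have hp := pairwise_openList σ k
  rw [openWord, openWord, h1, h2, List.map_append, List.map_cons, List.map_append, h.color,
    traceWord_append_cons]
  intro u hu
  obtain ⟨i, hi, rfl⟩ := List.mem_map.1 hu
  rw [h1, List.pairwise_append] at hp
  have hi' := mem_openList.1 (h1 ▸ List.mem_append_left _ hi)
  rw [← h.color k]
  refine (h.cross (σ k) i (hp.2.2 i hi _ (by simp)) ?_ ?_).symm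
  · rw [h.invol]; exact hi'.1
  · rw [h.invol]
    refine hi'.2.imp_right fun hle => lt_of_le_of_ne hle fun heq => ?_
    have := hp.2.2 i hi (σ k) (by simp)
    rw [heq, h.invol] at this
    exact lt_irrefl _ this

theorem cayleyAdj (h : IsColoredMatching G σ c) (k : Fin n) :
    CayleyAdj G (openWord G σ c k) (openWord G σ c (k + 1)) := by
  rcases le_or_gt k (σ k) with hk | hk
  · exact ⟨c k, Or.inr (h.openWord_succ k hk)⟩
  · exact ⟨c k, Or.inl (h.openWord_eq k hk)⟩

theorem direction_and_color_eq (h : IsColoredMatching G σ c) (h' : IsColoredMatching G τ d)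
    (hw : ∀ k ≤ n, openWord G σ c k = openWord G τ d k) (k : Fin n) :
    (σ k < k ↔ τ k < k) ∧ c k = d k := by
  have e1 := congrArg (fun x => (traceLetters G x).toAdd) (hw k k.2.le)
  have e2 := congrArg (fun x => (traceLetters G x).toAdd) (hw (k + 1) k.2)
  have key : ∀ {ρ : Fin n → Fin n} {f : Fin n → V}, IsColoredMatching G ρ f →
      (k ≤ ρ k ∧ (traceLetters G (openWord G ρ f (k + 1))).toAdd =
        f k ::ₘ (traceLetters G (openWord G ρ f k)).toAdd) ∨
      (ρ k < k ∧ (traceLetters G (openWord G ρ f k)).toAdd =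
        f k ::ₘ (traceLetters G (openWord G ρ f (k + 1))).toAdd) := by
    intro ρ f hf
    rcases le_or_gt k (ρ k) with hk | hk
    · left
      refine ⟨hk, ?_⟩
      rw [hf.openWord_succ k hk]
      simp [traceLetters, ← Multiset.singleton_add]
    · right
      refine ⟨hk, ?_⟩
      rw [hf.openWord_eq k hk]
      simp [traceLetters, ← Multiset.singleton_add]
  rcases key h with ⟨h1, h2⟩ | ⟨h1, h2⟩ <;> rcases key h' with ⟨h3, h4⟩ | ⟨h3, h4⟩
  · rw [← e1, ← e2, h2, Multiset.cons_inj_left] at h4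
    exact ⟨iff_of_false (not_lt.2 h1) (not_lt.2 h3), h4⟩
  · rw [← e1, ← e2, h2] at h4
    have := congrArg Multiset.card h4
    simp at this
    omega
  · rw [← e1, ← e2, h2] at h4
    have := congrArg Multiset.card h4
    simp at this
    omega
  · rw [← e1, ← e2, h2, Multiset.cons_inj_left] at h4
    exact ⟨iff_of_true h1 h3, h4⟩

theorem not_lt_of_eq_below (h : IsColoredMatching G σ c) (h' : IsColoredMatching G τ c)
    (hσ : ∀ i, σ i ≠ i) (k : Fin n) (hk : τ k < k)
    (ih : ∀ j < k, σ j < j → σ j = τ j) : ¬ σ k < τ k := by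
  intro hlt
  have hσk := h.invol k
  have hτk := h'.invol k
  have hne : σ (τ k) ≠ k := fun he => by
    have := h.invol (τ k)
    rw [he] at this
    exact hlt.ne this
  have hgt : k < σ (τ k) := by
    by_contra! hle
    have hlt' : σ (τ k) < k := lt_of_le_of_ne hle hne
    rcases lt_or_gt_of_ne (hσ (τ k)) with h1 | h1
    · rw [ih _ hk h1, hτk] at hlt'
      exact lt_irrefl _ hlt'
    · have h2 := ih _ hlt' (by rwa [h.invol])
      rw [h.invol] at h2
      have h3 := congrArg τ h2
      rw [hτk, h'.invol] at h3
      exact hne h3.symm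
  refine (h.cross (σ k) (τ k) hlt (by rwa [hσk]) (Or.inr (by rwa [hσk]))).ne ?_
  rw [h.color, h'.color]

/-- A coloured perfect matching is determined by its path in the Cayley graph. -/
theorem eq_of_openWord_eq (h : IsColoredMatching G σ c) (h' : IsColoredMatching G τ d)
    (hσ : ∀ i, σ i ≠ i) (hτ : ∀ i, τ i ≠ i)
    (hw : ∀ k ≤ n, openWord G σ c k = openWord G τ d k) : σ = τ ∧ c = d := by
  have hdir := fun k => (h.direction_and_color_eq h' hw k).1
  obtain rfl : c = d := funext fun k => (h.direction_and_color_eq h' hw k).2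
  refine ⟨?_, rfl⟩
  have down : ∀ k, σ k < k → σ k = τ k := by
    intro k
    induction k using WellFoundedLT.induction with
    | ind k ih =>
      intro hk
      rcases lt_trichotomy (σ k) (τ k) with hlt | heq | hlt
      · exact absurd hlt (h.not_lt_of_eq_below h' hσ k ((hdir k).1 hk) ih)
      · exact heq
      · exact absurd hlt (h'.not_lt_of_eq_below h hτ k hk
          fun j hj hj' => (ih j hj ((hdir j).2 hj')).symm)
  funext k
  rcases lt_or_gt_of_ne (hσ k) with hk | hk
  · exact down k hk
  · have := congrArg τ (down (σ k) (by rwa [h.invol]))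
    rw [h'.invol, h.invol] at this
    exact this.symm

/-- Matching an open position `i` with a new position `k`. -/
theorem close (h : IsColoredMatching G σ c) {i k : Fin n} (hfix : ∀ j, k ≤ j → σ j = j)
    (hik : i < k) (hi : σ i = i) (hc : c i = c k)
    (hadj : ∀ j, i < j → j < k → σ j = j → G.Adj (c j) (c k)) :
    IsColoredMatching G (fun x => Equiv.swap i k (σ x)) c := by
  have hk := hfix k le_rfl
  have hinv := h.invol
  have hval : ∀ x, Equiv.swap i k (σ x) = if x = i then k else if x = k then i else σ x := by
    intro x
    have := hinv x
    rw [Equiv.swap_apply_def]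
    grind
  refine ⟨fun x => ?_, fun x => ?_, fun x y hxy hy hor => ?_⟩
  · rw [hval, hval]
    have := hinv x
    grind
  · rw [hval]
    have := h.color x
    grind
  · rw [hval] at hy
    rw [hval, hval] at hor
    have h1 := h.cross x y hxy
    have h2 := hadj y
    have h3 := hfix x
    have h4 := hfix (σ x)
    have h5 := hfix (σ y)
    have h6 := hinv x
    have h7 := hinv y
    by_cases hxi : x = i
    · subst hxi
      simp only [if_true] at hy hor
      rw [hc]
      exact (hadj y hxy hy (by grind)).symm
    · grind

end IsColoredMatching

/-- Every walk in the Cayley graph from the empty word comes from a coloured matching. -/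
theorem exists_isColoredMatching {V : Type*} (G : SimpleGraph V) {n : ℕ} (c : Fin n → V)
    (w : ℕ → TraceMonoid G) (h0 : w 0 = 1)
    (hw : ∀ k : Fin n, w k = tmOf G (c k) * w (k + 1) ∨ w (k + 1) = tmOf G (c k) * w k)
    (k : ℕ) (hk : k ≤ n) :
    ∃ σ : Fin n → Fin n, IsColoredMatching G σ c ∧ (∀ i : Fin n, k ≤ i.val → σ i = i) ∧
      ∀ j ≤ k, w j = openWord G σ c j := by
  induction k with
  | zero =>
    refine ⟨id, ⟨fun _ => rfl, fun _ => rfl, fun i j h1 h2 => absurd h1 (lt_asymm h2)⟩,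
      fun _ _ => rfl, ?_⟩
    intro j hj
    obtain rfl : j = 0 := by omega
    have : openList (id : Fin n → Fin n) 0 = [] := by simp [openList]
    simp [openWord, this, h0]
  | succ k ih =>
    obtain ⟨σ, hσ, hfix, hword⟩ := ih (by omega)
    obtain ⟨k, rfl⟩ : ∃ k' : Fin n, k'.val = k := ⟨⟨k, hk⟩, rfl⟩
    rcases hw k with hdown | hup
    · rw [hword k le_rfl, openWord] at hdown
      obtain ⟨a', b', hab, hadj, hx⟩ := exists_split_of_traceWord_eq G _ _ _ hdown
      obtain ⟨a, m, hl, rfl, hm⟩ := List.map_eq_append_iff.1 hab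
      obtain ⟨i, b, rfl, hic, rfl⟩ := List.map_eq_cons_iff.1 hm
      have hi := mem_openList.1 (show i ∈ openList σ k by simp [hl])
      have hik : i < k := hi.1
      have hσi : σ i = i := by
        refine hi.2.elim id fun hle => ?_
        rw [← hfix _ hle, hσ.invol]
      have hp := pairwise_openList σ k
      rw [hl] at hp
      have hnew := hσ.close (i := i) (k := k) hfix hik hσi hic fun j hij hjk hj => by
        have hmem : j ∈ a ++ i :: b := hl ▸ mem_openList.2 ⟨hjk, Or.inl hj⟩
        rw [List.pairwise_append, List.pairwise_cons] at hp
        simp only [List.mem_append, List.mem_cons] at hmem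
        rcases hmem with hmem | hmem | hmem
        · exact hadj _ (List.mem_map_of_mem hmem)
        · exact absurd hmem hij.ne'
        · exact absurd hij (lt_asymm (hp.2.1.1 j hmem))
      have hval : Equiv.swap i k (σ k) = i := by rw [hfix k le_rfl, Equiv.swap_apply_right]
      have hlist : ∀ j ≤ k.val, openList (fun x => Equiv.swap i k (σ x)) j = openList σ j := by
        intro j hj
        apply List.eq_of_pairwise_gt_of_mem_iff (pairwise_openList _ _) (pairwise_openList _ _)
        intro x
        rw [mem_openList, mem_openList, Equiv.swap_apply_def]
        have := hσ.invol x
        have := hfix k le_rfl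
        grind
      refine ⟨_, hnew, fun x hx => ?_, fun j hj => ?_⟩
      · have hx' := hfix x (by omega)
        rw [hx', Equiv.swap_apply_of_ne_of_ne] <;> rintro rfl <;> omega
      · rcases Nat.lt_or_ge k j with hkj | hkj
        · obtain rfl : j = k + 1 := by omega
          obtain ⟨a₁, b₁, h1, h2⟩ := openList_eq_of_lt (σ := fun x => Equiv.swap i k (σ x)) k
            (by rwa [hval]) hnew.invol
          rw [hlist k le_rfl, hl, hval] at h1
          have hnd : (a ++ i :: b).Nodup := hp.imp ne_of_gt
          have hi₁ : i ∉ a ++ b := (List.nodup_middle.1 hnd).notMem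
          rw [h1] at hnd
          have hi₂ : i ∉ a₁ ++ b₁ := (List.nodup_middle.1 hnd).notMem
          have heq : a ++ b = a₁ ++ b₁ := by
            have := congrArg (List.erase · i) h1
            simp only [List.mem_append, not_or] at hi₁ hi₂
            simpa [List.erase_append_right _ hi₁.1, List.erase_append_right _ hi₂.1] using this
          rw [openWord, h2, ← heq, List.map_append, hx]
        · rw [hword j hkj, openWord, openWord, hlist j hkj]
    · refine ⟨σ, hσ, fun i hi => hfix i (by omega), fun j hj => ?_⟩
      rcases Nat.lt_or_ge k j with hkj | hkj
      · obtain rfl : j = k + 1 := by omega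
        rw [hup, hword k le_rfl, hσ.openWord_succ k (hfix k le_rfl).ge]
      · exact hword j hkj

theorem openList_eq_nil {n : ℕ} {σ : Fin n → Fin n} (hσ : ∀ i, σ i ≠ i) :
    openList σ n = [] := by
  simp [openList, hσ]

theorem openList_zero {n : ℕ} (σ : Fin n → Fin n) : openList σ 0 = [] := by
  simp [openList]

theorem ne_of_openWord_eq_one {V : Type*} {G : SimpleGraph V} {n : ℕ} {σ : Fin n → Fin n}
    {c : Fin n → V} (h : openWord G σ c n = 1) (i : Fin n) : σ i ≠ i := by
  intro hi
  have h1 := congrArg (fun x => (traceLetters G x).toAdd) h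
  simp only [openWord, traceLetters_traceWord, map_one, toAdd_one, Multiset.coe_eq_zero,
    List.map_eq_nil_iff] at h1
  have h2 : i ∈ openList σ n := mem_openList.2 ⟨i.2, Or.inl hi⟩
  simp [h1] at h2

theorem IsPairPartition.exists_partner {n : ℕ} {π : Finpartition (Finset.univ : Finset (Fin n))}
    (hπ : IsPairPartition π) (i : Fin n) : ∃ j, j ≠ i ∧ π.part i = {i, j} := by
  obtain ⟨x, y, hxy, hp⟩ := Finset.card_eq_two.1 (hπ _ (π.part_mem.2 (Finset.mem_univ i)))
  have hi : i ∈ π.part i := π.mem_part (Finset.mem_univ i)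
  rw [hp, Finset.mem_insert, Finset.mem_singleton] at hi
  rcases hi with rfl | rfl
  · exact ⟨y, hxy.symm, hp⟩
  · exact ⟨x, hxy, by rw [hp, Finset.pair_comm]⟩

namespace PairPartHoms

variable {L : ℕ} {G : SimpleGraph (Fin L)} {p : ℕ}

/-- The other element of the block containing `i`. -/
noncomputable def partner (x : PairPartHoms G p) (i : Fin (2 * p)) : Fin (2 * p) :=
  (x.1.2.exists_partner i).choose

/-- The block containing `i`. -/
def block (x : PairPartHoms G p) (i : Fin (2 * p)) : {b // b ∈ x.1.1.parts} :=
  ⟨x.1.1.part i, x.1.1.part_mem.2 (Finset.mem_univ i)⟩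

/-- The image in `G` of the block containing `i`. -/
def color (x : PairPartHoms G p) (i : Fin (2 * p)) : Fin L :=
  x.2 (x.block i)

theorem partner_ne (x : PairPartHoms G p) (i : Fin (2 * p)) : x.partner i ≠ i :=
  (x.1.2.exists_partner i).choose_spec.1

theorem part_eq (x : PairPartHoms G p) (i : Fin (2 * p)) : x.1.1.part i = {i, x.partner i} :=
  (x.1.2.exists_partner i).choose_spec.2

theorem part_partner (x : PairPartHoms G p) (i : Fin (2 * p)) :
    x.1.1.part (x.partner i) = x.1.1.part i :=
  x.1.1.part_eq_of_mem (x.1.1.part_mem.2 (Finset.mem_univ i)) (by simp [part_eq x i])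

theorem partner_eq_of_part_eq (x : PairPartHoms G p) {i j : Fin (2 * p)} (hij : j ≠ i)
    (h : x.1.1.part i = {i, j}) : x.partner i = j := by
  have hj : j ∈ x.1.1.part i := by simp [h]
  rw [part_eq, Finset.mem_insert, Finset.mem_singleton] at hj
  exact (hj.resolve_left hij).symm

theorem isColoredMatching (x : PairPartHoms G p) :
    IsColoredMatching G x.partner x.color where
  invol i := x.partner_eq_of_part_eq (x.partner_ne i).symm <| by
    rw [part_partner, part_eq, Finset.pair_comm]
  color i := congrArg x.2 (Subtype.ext (x.part_partner i))
  cross i j hij hj hor := by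
    have hlt := hor.resolve_left (x.partner_ne j)
    refine x.2.map_adj ((SimpleGraph.fromRel_adj _ _ _).2 ⟨fun he => ?_, Or.inl ?_⟩)
    · have hmem : j ∈ x.1.1.part i := by
        rw [show x.1.1.part i = x.1.1.part j from congrArg Subtype.val he, part_eq]
        simp
      rw [part_eq, Finset.mem_insert, Finset.mem_singleton] at hmem
      exact hmem.elim hij.ne' hj.ne
    · exact ⟨i, j, x.partner i, x.partner j, hij, hj, hlt, x.part_eq i, x.part_eq j⟩

theorem ext_partner_color {x y : PairPartHoms G p} (h : x.partner = y.partner)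
    (hc : x.color = y.color) : x = y := by
  have hpart : ∀ i, x.1.1.part i = y.1.1.part i := fun i => by rw [part_eq, part_eq, h]
  obtain ⟨⟨π, hπ⟩, φ⟩ := x
  obtain ⟨⟨ρ, hρ⟩, ψ⟩ := y
  dsimp only at hpart
  have hsub : ∀ {π ρ : Finpartition (Finset.univ : Finset (Fin (2 * p)))},
      (∀ i, π.part i = ρ.part i) → π.parts ⊆ ρ.parts := by
    intro π ρ hpart b hb
    obtain ⟨i, hi⟩ := π.nonempty_of_mem_parts hb
    rw [← π.part_eq_of_mem hb hi, hpart]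
    exact ρ.part_mem.2 (Finset.mem_univ i)
  obtain rfl : π = ρ := Finpartition.ext (hsub hpart |>.antisymm (hsub fun i => (hpart i).symm))
  obtain rfl : φ = ψ := by
    ext1 ⟨b, hb⟩
    obtain ⟨i, hi⟩ := π.nonempty_of_mem_parts hb
    obtain rfl := π.part_eq_of_mem hb hi
    exact congrFun hc i
  rfl

/-- The pair partition into the orbits of an involution without fixed points. -/
def orbitPartition {n : ℕ} (σ : Fin n → Fin n) (hσ : ∀ i, σ (σ i) = i) :
    Finpartition (Finset.univ : Finset (Fin n)) :=
  Finpartition.ofExistsUnique (Finset.univ.image fun i => {i, σ i})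
    (fun _ _ => Finset.subset_univ _)
    (fun i _ => by
      refine ⟨{i, σ i}, by simp, ?_⟩
      rintro b ⟨hb, hi⟩
      obtain ⟨j, -, rfl⟩ := Finset.mem_image.1 hb
      rw [Finset.mem_insert, Finset.mem_singleton] at hi
      rcases hi with rfl | rfl
      · rfl
      · rw [hσ, Finset.pair_comm])
    (by simp)

theorem part_orbitPartition {n : ℕ} (σ : Fin n → Fin n) (hσ : ∀ i, σ (σ i) = i) (i : Fin n) :
    (orbitPartition σ hσ).part i = {i, σ i} :=
  (orbitPartition σ hσ).part_eq_of_mem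
    (Finset.mem_image_of_mem _ (Finset.mem_univ i)) (by simp)

theorem exists_partner_color_eq {σ : Fin (2 * p) → Fin (2 * p)} {c : Fin (2 * p) → Fin L}
    (h : IsColoredMatching G σ c) (hσ : ∀ i, σ i ≠ i) :
    ∃ x : PairPartHoms G p, x.partner = σ ∧ x.color = c := by
  set π := orbitPartition σ h.invol
  have hpart : ∀ i, π.part i = {i, σ i} := part_orbitPartition σ h.invol
  have hblock : ∀ b ∈ π.parts, ∀ i ∈ b, b = {i, σ i} := fun b hb i hi => by
    rw [← hpart, π.part_eq_of_mem hb hi]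
  have hpair : IsPairPartition π := fun b hb => by
    obtain ⟨i, hi⟩ := π.nonempty_of_mem_parts hb
    rw [hblock b hb i hi, Finset.card_pair (hσ i).symm]
  let f : {b // b ∈ π.parts} → Fin L := fun b => c (b.1.min' (π.nonempty_of_mem_parts b.2))
  have hf : ∀ b : {b // b ∈ π.parts}, ∀ i ∈ b.1, f b = c i := fun b i hi => by
    have hm := Finset.min'_mem b.1 (π.nonempty_of_mem_parts b.2)
    have hm := (hblock b.1 b.2 i hi).subset hm
    rw [Finset.mem_insert, Finset.mem_singleton] at hm
    rcases hm with hm | hm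
    · exact congrArg c hm
    · exact (congrArg c hm).trans (h.color i)
  have hcross : ∀ b b' : {b // b ∈ π.parts}, Crosses b.1 b'.1 → G.Adj (f b) (f b') := by
    rintro b b' ⟨u₁, u₂, v₁, v₂, h1, h2, h3, hb, hb'⟩
    have e : ∀ (b : {b // b ∈ π.parts}) (u v : Fin (2 * p)), u < v → b.1 = {u, v} →
        σ u = v := by
      intro b u v huv hb
      have hv : v ∈ b.1 := by simp [hb]
      rw [hblock b.1 b.2 u (by simp [hb]), Finset.mem_insert, Finset.mem_singleton] at hv
      exact (hv.resolve_left huv.ne').symm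
    rw [hf b u₁ (by simp [hb]), hf b' u₂ (by simp [hb'])]
    have e1 := e b u₁ v₁ (h1.trans h2) hb
    have e2 := e b' u₂ v₂ (h2.trans h3) hb'
    exact h.cross u₁ u₂ h1 (by rwa [e1]) (Or.inr (by rwa [e1, e2]))
  let x : PairPartHoms G p := ⟨⟨π, hpair⟩, f, fun {b b'} hadj => by
    rcases ((SimpleGraph.fromRel_adj _ _ _).1 hadj).2 with hc | hc
    · exact hcross b b' hc
    · exact (hcross b' b hc).symm⟩
  exact ⟨x, funext fun i => x.partner_eq_of_part_eq (hσ i) (hpart i),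
    funext fun i => hf _ i (π.mem_part (Finset.mem_univ i))⟩

/-- The path recording, at each time, the product of the colours of the open blocks. -/
noncomputable def toClosedPath (x : PairPartHoms G p) : ClosedPaths G p :=
  ⟨fun k => openWord G x.partner x.color k,
    by simp [openWord, openList_zero],
    by simp [openWord, openList_eq_nil x.partner_ne],
    fun k => x.isColoredMatching.cayleyAdj k⟩

theorem toClosedPath_injective : Function.Injective (toClosedPath (G := G) (p := p)) := by
  intro x y hxy
  have hw : ∀ k ≤ 2 * p, openWord G x.partner x.color k = openWord G y.partner y.color k :=
    fun k hk => congrFun (congrArg Subtype.val hxy) ⟨k, Nat.lt_succ_of_le hk⟩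
  obtain ⟨h, hc⟩ := x.isColoredMatching.eq_of_openWord_eq y.isColoredMatching
    x.partner_ne y.partner_ne hw
  exact ext_partner_color h hc

theorem toClosedPath_surjective : Function.Surjective (toClosedPath (G := G) (p := p)) := by
  rintro ⟨w, h0, h1, hw⟩
  choose c hc using id hw
  let w' : ℕ → TraceMonoid G := fun k => if hk : k < 2 * p + 1 then w ⟨k, hk⟩ else 1
  have hw' : ∀ k : Fin (2 * p + 1), w' k = w k := fun k => dif_pos k.2
  obtain ⟨σ, hσ, -, hword⟩ := exists_isColoredMatching G c w' ((hw' 0).trans h0)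
    (fun k => by
      have := hc k
      rwa [← hw', ← hw'] at this) (2 * p) le_rfl
  have hne : ∀ i, σ i ≠ i := ne_of_openWord_eq_one (G := G) (c := c) <| by
    rw [← hword _ le_rfl, ← h1, ← hw', Fin.val_last]
  obtain ⟨x, rfl, rfl⟩ := exists_partner_color_eq hσ hne
  exact ⟨x, Subtype.ext <| funext fun k =>
    (hword k (Nat.le_of_lt_succ k.2)).symm.trans (hw' k)⟩

end PairPartHoms

/-- There is a bijection between pairs `(π,φ)` of a pair partition with a homomorphism
`F_π → G`, and closed paths of length `2p` at the empty word in the Cayley graph of the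
trace monoid `T(G)`. -/
theorem pairPartHoms_equiv_closedPaths {L : ℕ} (G : SimpleGraph (Fin L)) (p : ℕ) :
    Nonempty (PairPartHoms G p ≃ ClosedPaths G p) := by
  exact ⟨Equiv.ofBijective PairPartHoms.toClosedPath
    ⟨PairPartHoms.toClosedPath_injective, PairPartHoms.toClosedPath_surjective⟩⟩
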